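/- arXiv:1805.05488 — 2 statements merged into one kernel-verified Lean document; each statement's English description precedes it below -/
import Mathlib

section
/- Let (A, B) be a complex Golay pair of length n. Then for each k = 0, 1, 2, 3, we have resum(i^k \star A)^2 + imsum(i^k \star A)^2 + resum(i^k \star B)^2 + imsum(i^k \star B)^2 = 2n, where c \star X denotes multiplying the j-th entry of X by c^j, and resum(X), imsum(X) denote the real and imaginary parts of the sum of the entries of X. -/
open Complex Finset

/-- The nonperiodic autocorrelation function of a sequence of length `n`. -/
noncomputable def autocorr (n : ℕ) (A : ℕ → ℂ) (s : ℕ) : ℂ :=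
  ∑ k ∈ Finset.range (n - s), A k * star (A (k + s))

/-- The entries of the first `n` terms of the sequence lie in `{1, -1, i, -i}`. -/
def IsQuaternarySeq (n : ℕ) (A : ℕ → ℂ) : Prop :=
  ∀ k < n, A k ∈ ({1, -1, Complex.I, -Complex.I} : Set ℂ)

/-- `(A, B)` is a complex Golay pair of length `n`. -/
def IsComplexGolayPair (n : ℕ) (A B : ℕ → ℂ) : Prop :=
  IsQuaternarySeq n A ∧ IsQuaternarySeq n B ∧
    ∀ s, 1 ≤ s → s ≤ n - 1 → autocorr n A s + autocorr n B s = 0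

/-- Positional scaling: multiply the `k`-th entry of the sequence by `c^k`. -/
noncomputable def posScale (c : ℂ) (X : ℕ → ℂ) : ℕ → ℂ := fun k => c ^ k * X k

/-- The real part of the sum of the first `n` entries of `X`. -/
noncomputable def resum (n : ℕ) (X : ℕ → ℂ) : ℝ := (∑ k ∈ Finset.range n, X k).re

/-- The imaginary part of the sum of the first `n` entries of `X`. -/
noncomputable def imsum (n : ℕ) (X : ℕ → ℂ) : ℝ := (∑ k ∈ Finset.range n, X k).im

/-- Extending a sequence by one entry adds one product to each autocorrelation. -/
lemma autocorr_succ {n s : ℕ} (X : ℕ → ℂ) (hs : s ≤ n) :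
    autocorr (n + 1) X s = autocorr n X s + X (n - s) * star (X n) := by
  unfold autocorr
  rw [Nat.sub_add_comm hs, Finset.sum_range_succ, Nat.sub_add_cancel hs]

lemma autocorr_self (n : ℕ) (X : ℕ → ℂ) : autocorr n X n = 0 := by
  simp [autocorr]

lemma sum_autocorr_succ (n : ℕ) (X : ℕ → ℂ) :
    ∑ s ∈ Finset.range (n + 1), autocorr (n + 1) X (s + 1) =
      ∑ s ∈ Finset.range n, autocorr n X (s + 1) +
        (∑ k ∈ Finset.range n, X k) * star (X n) := by
  rw [Finset.sum_range_succ, autocorr_self, add_zero, Finset.sum_mul,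
    ← Finset.sum_range_reflect (fun k => X k * star (X n)), ← Finset.sum_add_distrib]
  refine Finset.sum_congr rfl fun s hs => ?_
  rw [autocorr_succ X (Finset.mem_range.mp hs), Nat.sub_sub, add_comm 1 s]

/-- The squared modulus of the sum of a sequence in terms of its autocorrelations. -/
lemma sum_mul_star_sum (n : ℕ) (X : ℕ → ℂ) :
    (∑ k ∈ Finset.range n, X k) * star (∑ k ∈ Finset.range n, X k) =
      ∑ k ∈ Finset.range n, X k * star (X k) +
        (∑ s ∈ Finset.range n, autocorr n X (s + 1) +
          star (∑ s ∈ Finset.range n, autocorr n X (s + 1))) := by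
  induction n with
  | zero => simp
  | succ n ih =>
    rw [sum_autocorr_succ, Finset.sum_range_succ, Finset.sum_range_succ]
    simp only [star_add, star_mul', star_star] at ih ⊢
    linear_combination ih

lemma autocorr_posScale {c : ℂ} (hc : c * star c = 1) (n : ℕ) (X : ℕ → ℂ) (s : ℕ) :
    autocorr n (posScale c X) s = star c ^ s * autocorr n X s := by
  unfold autocorr posScale
  rw [Finset.mul_sum]
  refine Finset.sum_congr rfl fun k _ => ?_
  have h : c ^ k * star c ^ k = 1 := by rw [← mul_pow, hc, one_pow]
  simp only [star_mul', star_pow, pow_add]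
  linear_combination X k * star c ^ s * star (X (k + s)) * h

lemma IsQuaternarySeq.sum_posScale_mul_star {n : ℕ} {X : ℕ → ℂ} (hX : IsQuaternarySeq n X)
    {c : ℂ} (hc : c * star c = 1) :
    ∑ k ∈ Finset.range n, posScale c X k * star (posScale c X k) = n := by
  have h : ∀ k ∈ Finset.range n, posScale c X k * star (posScale c X k) = 1 := by
    intro k hk
    have hXk : X k * star (X k) = 1 := by
      have hmem := hX k (Finset.mem_range.mp hk)
      simp only [Set.mem_insert_iff, Set.mem_singleton_iff] at hmem
      rcases hmem with h | h | h | h <;> simp [h]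
    simp only [posScale, star_mul', star_pow]
    rw [mul_mul_mul_comm, ← mul_pow, hc, hXk, one_pow, one_mul]
  rw [Finset.sum_congr rfl h]
  simp

lemma ofReal_resum_sq_add_imsum_sq (n : ℕ) (X : ℕ → ℂ) :
    ((resum n X ^ 2 + imsum n X ^ 2 : ℝ) : ℂ) =
      (∑ k ∈ Finset.range n, X k) * star (∑ k ∈ Finset.range n, X k) := by
  rw [Complex.star_def, Complex.mul_conj, Complex.normSq_apply, resum, imsum, sq, sq]

lemma IsComplexGolayPair.sum_autocorr_posScale {n : ℕ} {A B : ℕ → ℂ}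
    (h : IsComplexGolayPair n A B) {c : ℂ} (hc : c * star c = 1) :
    ∑ s ∈ Finset.range n, autocorr n (posScale c A) (s + 1) +
      ∑ s ∈ Finset.range n, autocorr n (posScale c B) (s + 1) = 0 := by
  rw [← Finset.sum_add_distrib]
  refine Finset.sum_eq_zero fun s hs => ?_
  rw [autocorr_posScale hc, autocorr_posScale hc, ← mul_add]
  have hs' := Finset.mem_range.mp hs
  rcases Nat.lt_or_ge (s + 1) n with hlt | hge
  · rw [h.2.2 (s + 1) (by omega) (by omega), mul_zero]
  · obtain rfl : n = s + 1 := by omega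
    simp [autocorr_self]

/-- The sum of squares identity for scaling by any `c` on the unit circle. -/
lemma IsComplexGolayPair.sum_of_squares_posScale {n : ℕ} {A B : ℕ → ℂ}
    (h : IsComplexGolayPair n A B) {c : ℂ} (hc : c * star c = 1) :
    resum n (posScale c A) ^ 2 + imsum n (posScale c A) ^ 2 +
      resum n (posScale c B) ^ 2 + imsum n (posScale c B) ^ 2 = 2 * n := by
  have hsum := h.sum_autocorr_posScale hc
  have hstar := congrArg star hsum
  rw [star_add, star_zero] at hstar
  have hA := ofReal_resum_sq_add_imsum_sq n (posScale c A)
  have hB := ofReal_resum_sq_add_imsum_sq n (posScale c B)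
  rw [sum_mul_star_sum, h.1.sum_posScale_mul_star hc] at hA
  rw [sum_mul_star_sum, h.2.1.sum_posScale_mul_star hc] at hB
  rw [add_assoc]
  apply Complex.ofReal_injective
  rw [Complex.ofReal_add, hA, hB]
  push_cast
  linear_combination hsum + hstar

/-- If `(A, B)` is a complex Golay pair of length `n`, then for
each `k = 0, 1, 2, 3`, the sums of squares of `resum` and `imsum` of the
positionally scaled sequences `i^k ⋆ A` and `i^k ⋆ B` equal `2n`. -/
theorem golay_sum_of_squares_scaled (n : ℕ) (A B : ℕ → ℂ) (h : IsComplexGolayPair n A B) :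
    ∀ k < 4,
      resum n (posScale (Complex.I ^ k) A) ^ 2 + imsum n (posScale (Complex.I ^ k) A) ^ 2 +
        resum n (posScale (Complex.I ^ k) B) ^ 2 + imsum n (posScale (Complex.I ^ k) B) ^ 2 =
        2 * n := by
  intro k _
  refine h.sum_of_squares_posScale ?_
  rw [star_pow, ← mul_pow]
  simp
end

section
/- Let (A, B) be a complex Golay pair of length n, and write a_k = i^{c_k} and b_k = i^{d_k} with c_k, d_k \in Z/4Z. Then for every s = 1, ..., n-1, \sum_{k=0}^{n-s-1} (c_k + c_{k+s} + d_k + d_{k+s}) \equiv 0 (mod 2). -/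
open Complex Finset

/-- The imaginary part of `i ^ p * conj (i ^ q)` is an integer of the same parity as `p + q`. -/
theorem exists_int_im_I_pow_mul_star_I_pow {p q : ℕ} (hp : p < 4) (hq : q < 4) :
    ∃ z : ℤ, (Complex.I ^ p * star (Complex.I ^ q)).im = z ∧ z ≡ (p + q : ℕ) [ZMOD 2] := by
  interval_cases p <;> interval_cases q <;>
    first
    | (refine ⟨0, ?_, by decide⟩; simp [Complex.I_pow_three])
    | (refine ⟨1, ?_, by decide⟩; simp [Complex.I_pow_three]; done)
    | (refine ⟨-1, ?_, by decide⟩; simp [Complex.I_pow_three])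

/-- The imaginary part of the autocorrelation of `i ^ c` is an integer of the same parity as the
sum of the exponents involved. -/
theorem exists_int_im_autocorr (n s : ℕ) (A : ℕ → ℂ) (c : ℕ → ZMod 4)
    (hc : ∀ k < n, A k = Complex.I ^ (c k).val) :
    ∃ z : ℤ, (autocorr n A s).im = z ∧
      z ≡ (∑ k ∈ Finset.range (n - s), ((c k).val + (c (k + s)).val) : ℕ) [ZMOD 2] := by
  choose z hz hmod using fun k =>
    exists_int_im_I_pow_mul_star_I_pow (ZMod.val_lt (c k)) (ZMod.val_lt (c (k + s)))
  refine ⟨∑ k ∈ Finset.range (n - s), z k, ?_, ?_⟩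
  · rw [autocorr, Complex.im_sum, Int.cast_sum]
    refine Finset.sum_congr rfl fun k hk => ?_
    rw [Finset.mem_range] at hk
    rw [hc k (by omega), hc (k + s) (by omega), hz]
  · rw [Nat.cast_sum]
    exact Int.ModEq.sum fun k _ => hmod k

/-- If `(A, B)` is a complex Golay pair of length `n` with
`aₖ = i^{cₖ}` and `bₖ = i^{dₖ}` for `cₖ, dₖ ∈ ℤ/4ℤ`, then for every
`s = 1, …, n-1`, `∑_{k=0}^{n-s-1} (cₖ + c_{k+s} + dₖ + d_{k+s}) ≡ 0 (mod 2)`. -/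
theorem golay_exponent_sum_parity (n : ℕ) (A B : ℕ → ℂ) (h : IsComplexGolayPair n A B)
    (c d : ℕ → ZMod 4)
    (hc : ∀ k < n, A k = Complex.I ^ (c k).val)
    (hd : ∀ k < n, B k = Complex.I ^ (d k).val) :
    ∀ s, 1 ≤ s → s ≤ n - 1 →
      (∑ k ∈ Finset.range (n - s),
        ((c k).val + (c (k + s)).val + (d k).val + (d (k + s)).val)) % 2 = 0 := by
  intro s hs hsn
  obtain ⟨z, hz, hzmod⟩ := exists_int_im_autocorr n s A c hc
  obtain ⟨w, hw, hwmod⟩ := exists_int_im_autocorr n s B d hd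
  have hzw : z + w = 0 := by
    have him := congrArg Complex.im (h.2.2 s hs hsn)
    rw [Complex.add_im, hz, hw, Complex.zero_im] at him
    exact_mod_cast him
  have hsplit : ∑ k ∈ Finset.range (n - s),
        ((c k).val + (c (k + s)).val + (d k).val + (d (k + s)).val) =
      ∑ k ∈ Finset.range (n - s), ((c k).val + (c (k + s)).val) +
        ∑ k ∈ Finset.range (n - s), ((d k).val + (d (k + s)).val) := by
    rw [← Finset.sum_add_distrib]
    exact Finset.sum_congr rfl fun k _ => by ring
  rw [hsplit]
  unfold Int.ModEq at hzmod hwmod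
  omega
end
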